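/- arXiv:1707.08732 — 2 statements merged into one kernel-verified Lean document; each statement's English description precedes it below -/
import Mathlib

section
/- The measure ν on ℝⁿ × (0,∞) with density e^{−1/z} z^{−(n+2)} is (−1)-concave: for all nonempty Borel sets A, B ⊆ ℝⁿ × (0,∞) with ν(A), ν(B) > 0 and all λ ∈ (0,1), ν((1−λ)A + λB) ≥ ( (1−λ) ν(A)⁻¹ + λ ν(B)⁻¹ )⁻¹, where (1−λ)A + λB is the Minkowski combination (and the left side is interpreted via outer measure if the Minkowski sum is not measurable). -/
open MeasureTheory Set Pointwise
open scoped ENNReal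

/-- The weighted power mean of `a` and `b` with exponent `-1/p`. -/
noncomputable def powMean (l p : ℝ) (a b : ℝ≥0∞) : ℝ≥0∞ :=
  (ENNReal.ofReal (1 - l) * a ^ (-p⁻¹) + ENNReal.ofReal l * b ^ (-p⁻¹)) ^ (-p)

section powMean

variable {l p : ℝ}

lemma powMean_zero_left (hl : l < 1) (hp : 0 < p) (b : ℝ≥0∞) : powMean l p 0 b = 0 := by
  have h : ENNReal.ofReal (1 - l) ≠ 0 := by simpa using hl
  rw [powMean, ENNReal.zero_rpow_of_neg (by simpa using hp), ENNReal.mul_top h, top_add,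
    ENNReal.top_rpow_of_neg (by simpa using hp)]

lemma powMean_zero_right (hl : 0 < l) (hp : 0 < p) (a : ℝ≥0∞) : powMean l p a 0 = 0 := by
  have h : ENNReal.ofReal l ≠ 0 := by simpa using hl
  rw [powMean, ENNReal.zero_rpow_of_neg (by simpa using hp), ENNReal.mul_top h, add_top,
    ENNReal.top_rpow_of_neg (by simpa using hp)]

lemma powMean_mono (hp : 0 < p) {a b c d : ℝ≥0∞} (hac : a ≤ c) (hbd : b ≤ d) :
    powMean l p a b ≤ powMean l p c d := by
  have hp' : 0 < p⁻¹ := inv_pos.2 hp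
  simp only [powMean, ENNReal.rpow_neg]
  gcongr

lemma continuous_powMean : Continuous fun x : ℝ≥0∞ × ℝ≥0∞ => powMean l p x.1 x.2 := by
  unfold powMean
  refine ENNReal.continuous_rpow_const.comp (Continuous.add ?_ ?_)
  · exact (ENNReal.continuous_const_mul ENNReal.ofReal_ne_top).comp
      (ENNReal.continuous_rpow_const.comp continuous_fst)
  · exact (ENNReal.continuous_const_mul ENNReal.ofReal_ne_top).comp
      (ENNReal.continuous_rpow_const.comp continuous_snd)

lemma powMean_mul (hp : 0 < p) {s : ℝ≥0∞} (hs0 : s ≠ 0) (hs : s ≠ ∞) (a b : ℝ≥0∞) :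
    powMean l p (s * a) (s * b) = s * powMean l p a b := by
  have h0 : s ^ (-p⁻¹) ≠ 0 := by simp [ENNReal.rpow_eq_zero_iff, hs0, hs]
  have h1 : s ^ (-p⁻¹) ≠ ∞ := by simp [ENNReal.rpow_eq_top_iff, hs0, hs]
  have h2 : s = (s ^ (-p⁻¹)) ^ (-p) := by
    rw [← ENNReal.rpow_mul, neg_mul_neg, inv_mul_cancel₀ hp.ne', ENNReal.rpow_one]
  have h3 (c : ℝ≥0∞) : (s * c) ^ (-p⁻¹) = s ^ (-p⁻¹) * c ^ (-p⁻¹) := by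
    rcases eq_or_ne c ∞ with rfl | hc
    · rw [ENNReal.mul_top hs0, ENNReal.top_rpow_of_neg (by simpa using hp), mul_zero]
    · exact ENNReal.mul_rpow_of_ne_top hs hc _
  conv_rhs => rw [h2]
  have h4 (c : ℝ≥0∞) : (s ^ (-p⁻¹) * c) ^ (-p) = (s ^ (-p⁻¹)) ^ (-p) * c ^ (-p) := by
    rcases eq_or_ne c ∞ with rfl | hc
    · rw [ENNReal.mul_top h0, ENNReal.top_rpow_of_neg (by simpa using hp), mul_zero]
    · exact ENNReal.mul_rpow_of_ne_top h1 hc _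
  rw [powMean, powMean, h3, h3, ← h4]
  congr 1
  ring

lemma powMean_ne_zero (hp : 0 < p) {a b : ℝ≥0∞} (ha : a ≠ 0) (hb : b ≠ 0) :
    powMean l p a b ≠ 0 := by
  have h (c : ℝ≥0∞) (hc : c ≠ 0) : c ^ (-p⁻¹) ≠ ∞ := by
    simp [ENNReal.rpow_eq_top_iff, hc, hp.le]
  rw [powMean, ne_eq, ENNReal.rpow_eq_zero_iff]
  simp [h a ha, h b hb, ENNReal.mul_eq_top, hp.le]

lemma powMean_ne_top (hl : l < 1) (hp : 0 < p) {a : ℝ≥0∞} (ha : a ≠ ∞) (b : ℝ≥0∞) :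
    powMean l p a b ≠ ∞ := by
  have h : a ^ (-p⁻¹) ≠ 0 := by simp [ENNReal.rpow_eq_zero_iff, ha, hp.le]
  rw [powMean, ne_eq, ENNReal.rpow_eq_top_iff]
  simp [h, hl, hp.le]

/-- Hölder's inequality for power means. -/
lemma powMean_mul_le (hl : l ∈ Ioo (0 : ℝ) 1) (hp : 0 < p) {F G : ℝ≥0∞} (hF0 : F ≠ 0)
    (hF : F ≠ ∞) (hG0 : G ≠ 0) (hG : G ≠ ∞) (x y : ℝ≥0∞) :
    powMean l p (F * x) (G * y) ≤
      powMean l (p + 1) F G * (ENNReal.ofReal (1 - l) * x + ENNReal.ofReal l * y) := by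
  have hp1 : 0 < p + 1 := by linarith
  have hw : ENNReal.ofReal (1 - l) ≠ 0 := by simpa using hl.2
  have hv : ENNReal.ofReal l ≠ 0 := by simpa using hl.1
  have hM := powMean_ne_zero (l := l) hp1 hF0 hG0
  rcases eq_or_ne x 0 with rfl | hx0
  · simp [powMean_zero_left hl.2 hp]
  rcases eq_or_ne y 0 with rfl | hy0
  · simp [powMean_zero_right hl.1 hp]
  rcases eq_or_ne x ∞ with rfl | hx
  · simp [ENNReal.mul_top, hw, hM]
  rcases eq_or_ne y ∞ with rfl | hy
  · simp [ENNReal.mul_top, hv, hM]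
  have key (w F x : ℝ≥0∞) (hF : F ≠ ∞) (hx0 : x ≠ 0)
      (hx : x ≠ ∞) : (w * x) ^ (1 / (p + 1)) * (w * (F * x) ^ (-p⁻¹)) ^ (p / (p + 1))
        = w * F ^ (-(p + 1)⁻¹) := by
    have e1 : 0 ≤ 1 / (p + 1) := by positivity
    have e2 : 0 ≤ p / (p + 1) := by positivity
    rw [ENNReal.mul_rpow_of_nonneg _ _ e1, ENNReal.mul_rpow_of_nonneg _ _ e2,
      ← ENNReal.rpow_mul, ENNReal.mul_rpow_of_ne_top hF hx]
    have e3 : w ^ (1 / (p + 1)) * w ^ (p / (p + 1)) = w := by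
      rw [← ENNReal.rpow_add_of_nonneg _ _ e1 e2, ← add_div, add_comm, div_self hp1.ne',
        ENNReal.rpow_one]
    have e4 : x ^ (1 / (p + 1)) * x ^ (-p⁻¹ * (p / (p + 1))) = 1 := by
      rw [← ENNReal.rpow_add _ _ hx0 hx]
      have : 1 / (p + 1) + -p⁻¹ * (p / (p + 1)) = 0 := by field_simp; ring
      rw [this, ENNReal.rpow_zero]
    have e5 : -p⁻¹ * (p / (p + 1)) = -(p + 1)⁻¹ := by field_simp
    rw [e5] at e4 ⊢
    calc _ = (w ^ (1 / (p + 1)) * w ^ (p / (p + 1))) * (x ^ (1 / (p + 1)) * x ^ (-(p + 1)⁻¹))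
          * F ^ (-(p + 1)⁻¹) := by ring
      _ = _ := by rw [e3, e4, mul_one]
  have hconj : (p + 1).HolderConjugate ((p + 1) / p) := by
    rw [Real.holderConjugate_iff]
    refine ⟨by linarith, by field_simp; ring⟩
  have holder := ENNReal.inner_le_Lp_mul_Lq (Finset.univ : Finset (Fin 2))
    ![(ENNReal.ofReal (1 - l) * x) ^ (1 / (p + 1)), (ENNReal.ofReal l * y) ^ (1 / (p + 1))]
    ![(ENNReal.ofReal (1 - l) * (F * x) ^ (-p⁻¹)) ^ (p / (p + 1)),
      (ENNReal.ofReal l * (G * y) ^ (-p⁻¹)) ^ (p / (p + 1))] hconj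
  have r1 : 1 / (p + 1) * (p + 1) = 1 := by field_simp
  have r2 : p / (p + 1) * ((p + 1) / p) = 1 := by field_simp
  have r3 : 1 / ((p + 1) / p) = p / (p + 1) := by field_simp
  simp only [Fin.sum_univ_two, Matrix.cons_val_zero, Matrix.cons_val_one, Matrix.cons_val_fin_one,
    ← ENNReal.rpow_mul, r1, r2, r3, ENNReal.rpow_one] at holder
  rw [key _ F x hF hx0 hx,
    key _ G y hG hy0 hy] at holder
  unfold powMean
  set S := ENNReal.ofReal (1 - l) * (F * x) ^ (-p⁻¹) + ENNReal.ofReal l * (G * y) ^ (-p⁻¹)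
  set T := ENNReal.ofReal (1 - l) * F ^ (-(p + 1)⁻¹) + ENNReal.ofReal l * G ^ (-(p + 1)⁻¹)
    with hT
  set X := ENNReal.ofReal (1 - l) * x + ENNReal.ofReal l * y
  have holder' : T ^ (p + 1) ≤ X * S ^ p := by
    have := ENNReal.rpow_le_rpow holder hp1.le
    rwa [ENNReal.mul_rpow_of_nonneg _ _ hp1.le, ← ENNReal.rpow_mul, ← ENNReal.rpow_mul, r1,
      div_mul_cancel₀ _ hp1.ne', ENNReal.rpow_one] at this
  have hT0 : T ^ (p + 1) ≠ 0 := by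
    have : F ^ (-(p + 1)⁻¹) ≠ 0 := by simp [ENNReal.rpow_eq_zero_iff, hF, hF0]
    simp [ENNReal.rpow_eq_zero_iff, hT, this, hl.2, hp1.le, hp1]
  have hTt : T ^ (p + 1) ≠ ∞ := by
    have h1 : F ^ (-(p + 1)⁻¹) ≠ ∞ := by simp [ENNReal.rpow_eq_top_iff, hF, hF0]
    have h2 : G ^ (-(p + 1)⁻¹) ≠ ∞ := by simp [ENNReal.rpow_eq_top_iff, hG, hG0]
    refine ENNReal.rpow_ne_top_of_nonneg hp1.le ?_
    simp [hT, h1, h2, ENNReal.mul_eq_top]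
  rw [ENNReal.rpow_neg, ENNReal.rpow_neg, mul_comm, ← div_eq_mul_inv,
    ENNReal.le_div_iff_mul_le (.inl hT0) (.inl hTt), mul_comm, ← div_eq_mul_inv]
  exact ENNReal.div_le_of_le_mul holder'

end powMean

/-- The Brunn–Minkowski inequality on the real line. -/
lemma Real.volume_add_le {A B : Set ℝ} (hA : MeasurableSet A) (hB : MeasurableSet B)
    (hA0 : A.Nonempty) (hB0 : B.Nonempty) : volume A + volume B ≤ volume (A + B) := by
  have compact (K L : Set ℝ) (hK : IsCompact K) (hL : IsCompact L) (hK0 : K.Nonempty)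
      (hL0 : L.Nonempty) : volume K + volume L ≤ volume (K + L) := by
    obtain ⟨a, haK, ha⟩ := hK.exists_isGreatest hK0
    obtain ⟨b, hbL, hb⟩ := hL.exists_isLeast hL0
    have hd : AEDisjoint volume (b +ᵥ K) (a +ᵥ L) := by
      refine measure_mono_null (t := {a + b}) ?_ (by simp)
      rintro _ ⟨⟨x, hx, rfl⟩, ⟨y, hy, hxy⟩⟩
      have h1 := ha hx
      have h2 := hb hy
      simp only [vadd_eq_add, mem_singleton_iff] at hxy ⊢
      linarith
    calc volume K + volume L = volume (b +ᵥ K) + volume (a +ᵥ L) := by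
          rw [measure_vadd, measure_vadd]
      _ = volume ((b +ᵥ K) ∪ (a +ᵥ L)) :=
          (measure_union₀ (hL.vadd a).measurableSet.nullMeasurableSet hd).symm
      _ ≤ volume (K + L) := by
          refine measure_mono (union_subset ?_ ?_)
          · rintro _ ⟨x, hx, rfl⟩
            exact ⟨x, hx, b, hbL, add_comm _ _⟩
          · rintro _ ⟨y, hy, rfl⟩
            exact ⟨a, haK, y, hy, rfl⟩
  obtain ⟨a, ha⟩ := hA0
  obtain ⟨b, hb⟩ := hB0
  rw [hA.measure_eq_iSup_isCompact, hB.measure_eq_iSup_isCompact]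
  simp only [iSup_and']
  refine ENNReal.biSup_add_biSup_le' ⟨∅, empty_subset _, isCompact_empty⟩
    ⟨∅, empty_subset _, isCompact_empty⟩ fun K hK L hL => ?_
  calc volume K + volume L ≤ volume (insert a K) + volume (insert b L) := by
        gcongr <;> exact subset_insert _ _
    _ ≤ volume (insert a K + insert b L) := compact _ _ (hK.2.insert a) (hL.2.insert b)
        (insert_nonempty _ _) (insert_nonempty _ _)
    _ ≤ volume (A + B) := measure_mono
        (add_subset_add (insert_subset ha hK.1) (insert_subset hb hL.1))

lemma Real.volume_convexComb_le {l : ℝ} (hl : l ∈ Ioo (0 : ℝ) 1) {A B : Set ℝ}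
    (hA : MeasurableSet A) (hB : MeasurableSet B) (hA0 : A.Nonempty) (hB0 : B.Nonempty) :
    ENNReal.ofReal (1 - l) * volume A + ENNReal.ofReal l * volume B
      ≤ volume ((1 - l) • A + l • B) := by
  have h1 : 0 < 1 - l := by linarith [hl.2]
  have h := Real.volume_add_le (hA.const_smul₀ (1 - l)) (hB.const_smul₀ l) hA0.smul_set
    hB0.smul_set
  simpa [Measure.addHaar_smul, abs_of_pos h1, abs_of_pos hl.1] using h

lemma lintegral_convexComb_le_of_min_le {l : ℝ} (hl : l ∈ Ioo (0 : ℝ) 1) {f g h : ℝ → ℝ≥0∞}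
    (hf : Measurable f) (hg : Measurable g) (hh : Measurable h) (hf1 : ⨆ x, f x = 1)
    (hg1 : ⨆ x, g x = 1) (hfgh : ∀ x y, min (f x) (g y) ≤ h ((1 - l) * x + l * y)) :
    ENNReal.ofReal (1 - l) * (∫⁻ x, f x) + ENNReal.ofReal l * ∫⁻ x, g x ≤ ∫⁻ x, h x := by
  have layer (u : ℝ → ℝ≥0∞) (hu : Measurable u) (hu1 : ∀ x, u x ≤ 1) :
      ∫⁻ x, u x = ∫⁻ t in Ioi (0 : ℝ), volume {x | ENNReal.ofReal t < u x} := by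
    have hfin (x : ℝ) : u x ≠ ∞ := ((hu1 x).trans_lt ENNReal.one_lt_top).ne
    have := lintegral_eq_lintegral_meas_lt volume (f := fun x => (u x).toReal)
      (.of_forall fun x => ENNReal.toReal_nonneg) hu.ennreal_toReal.aemeasurable
    simp only [ENNReal.ofReal_toReal (hfin _)] at this
    rw [this]
    refine setLIntegral_congr_fun measurableSet_Ioi fun t ht => ?_
    simp only [ENNReal.ofReal_lt_iff_lt_toReal (le_of_lt ht) (hfin _)]
  have hfle (x : ℝ) : f x ≤ 1 := hf1 ▸ le_iSup f x
  have hgle (x : ℝ) : g x ≤ 1 := hg1 ▸ le_iSup g x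
  have meas (u : ℝ → ℝ≥0∞) : Measurable fun t : ℝ => volume {x | ENNReal.ofReal t < u x} :=
    Antitone.measurable fun s t hst => measure_mono fun x hx =>
      (ENNReal.ofReal_le_ofReal hst).trans_lt hx
  calc ENNReal.ofReal (1 - l) * (∫⁻ x, f x) + ENNReal.ofReal l * ∫⁻ x, g x
      = ∫⁻ t in Ioi (0 : ℝ), (ENNReal.ofReal (1 - l) * volume {x | ENNReal.ofReal t < f x}
          + ENNReal.ofReal l * volume {x | ENNReal.ofReal t < g x}) := by
        rw [layer f hf hfle, layer g hg hgle, lintegral_add_left ((meas f).const_mul _),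
          lintegral_const_mul _ (meas f), lintegral_const_mul _ (meas g)]
    _ ≤ ∫⁻ t in Ioi (0 : ℝ), volume {x | ENNReal.ofReal t < min (h x) 1} := by
        refine setLIntegral_mono (meas _) fun t _ => ?_
        rcases lt_or_ge (ENNReal.ofReal t) 1 with ht1 | ht1
        · have nef : {x | ENNReal.ofReal t < f x}.Nonempty := by
            exact lt_iSup_iff.1 (ht1.trans_eq hf1.symm)
          have neg : {x | ENNReal.ofReal t < g x}.Nonempty := by
            exact lt_iSup_iff.1 (ht1.trans_eq hg1.symm)
          refine (Real.volume_convexComb_le hl (measurableSet_lt measurable_const hf)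
            (measurableSet_lt measurable_const hg) nef neg).trans (measure_mono ?_)
          rintro _ ⟨_, ⟨x, hx, rfl⟩, _, ⟨y, hy, rfl⟩, rfl⟩
          exact lt_min ((lt_min hx hy).trans_le (hfgh x y)) ht1
        · have ef : {x | ENNReal.ofReal t < f x} = ∅ :=
            eq_empty_of_forall_notMem fun x hx => not_lt.2 ((hfle x).trans ht1) hx
          have eg : {x | ENNReal.ofReal t < g x} = ∅ :=
            eq_empty_of_forall_notMem fun x hx => not_lt.2 ((hgle x).trans ht1) hx
          simp [ef, eg]
    _ = ∫⁻ x, min (h x) 1 :=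
        (layer _ (hh.min measurable_const) fun x => min_le_right _ _).symm
    _ ≤ ∫⁻ x, h x := lintegral_mono fun x => min_le_left _ _

/-- The Borell–Brascamp–Lieb property of a measure: a function dominating the `(-1/p)`-means of
`f` and `g` has integral dominating the `(-1/q)`-mean of the integrals of `f` and `g`. -/
def BorellBrascampLieb {E : Type*} [MeasurableSpace E] [AddCommGroup E] [Module ℝ E]
    (μ : Measure E) (l p q : ℝ) : Prop :=
  ∀ f g h : E → ℝ≥0∞, Measurable f → Measurable g → Measurable h →
    (∀ x y, powMean l p (f x) (g y) ≤ h ((1 - l) • x + l • y)) →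
      powMean l q (∫⁻ x, f x ∂μ) (∫⁻ x, g x ∂μ) ≤ ∫⁻ x, h x ∂μ

lemma powMean_lintegral_le_of_bounded {l p : ℝ} (hl : l ∈ Ioo (0 : ℝ) 1) (hp : 0 < p)
    {f g h : ℝ → ℝ≥0∞} (hf : Measurable f) (hg : Measurable g) (hh : Measurable h)
    (hfb : ⨆ x, f x ≠ ∞) (hgb : ⨆ x, g x ≠ ∞)
    (hfgh : ∀ x y, powMean l (p + 1) (f x) (g y) ≤ h ((1 - l) * x + l * y)) :
    powMean l p (∫⁻ x, f x) (∫⁻ x, g x) ≤ ∫⁻ x, h x := by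
  have hp1 : 0 < p + 1 := by linarith
  set F := ⨆ x, f x
  set G := ⨆ x, g x
  rcases eq_or_ne F 0 with hF0 | hF0
  · have : f = 0 := funext fun x => by simpa using (le_iSup f x).trans_eq hF0
    simp [this, powMean_zero_left hl.2 hp]
  rcases eq_or_ne G 0 with hG0 | hG0
  · have : g = 0 := funext fun x => by simpa using (le_iSup g x).trans_eq hG0
    simp [this, powMean_zero_right hl.1 hp]
  set m := powMean l (p + 1) F G with hm
  have hm0 : m ≠ 0 := powMean_ne_zero hp1 hF0 hG0
  have hmt : m ≠ ∞ := powMean_ne_top hl.2 hp1 hfb G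
  have normalized := lintegral_convexComb_le_of_min_le hl (hf.const_mul F⁻¹)
    (hg.const_mul G⁻¹) (hh.const_mul m⁻¹)
    (by rw [← ENNReal.mul_iSup, ENNReal.inv_mul_cancel hF0 hfb])
    (by rw [← ENNReal.mul_iSup, ENNReal.inv_mul_cancel hG0 hgb]) fun x y => by
      set s := min (F⁻¹ * f x) (G⁻¹ * g y)
      rcases eq_or_ne s 0 with hs0 | hs0
      · simp [hs0]
      have hsf : s * F ≤ f x := by
        calc s * F ≤ F⁻¹ * f x * F := by gcongr; exact min_le_left _ _
          _ = f x := by rw [mul_right_comm, ENNReal.inv_mul_cancel hF0 hfb, one_mul]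
      have hsg : s * G ≤ g y := by
        calc s * G ≤ G⁻¹ * g y * G := by gcongr; exact min_le_right _ _
          _ = g y := by rw [mul_right_comm, ENNReal.inv_mul_cancel hG0 hgb, one_mul]
      have hst : s ≠ ∞ := by
        rintro h
        rw [h, ENNReal.top_mul hF0] at hsf
        exact hfb (top_le_iff.1 (hsf.trans (le_iSup f x)))
      rw [← ENNReal.div_eq_inv_mul, ENNReal.le_div_iff_mul_le (.inl hm0) (.inl hmt), hm,
        ← powMean_mul hp1 hs0 hst]
      exact (powMean_mono hp1 hsf hsg).trans (hfgh x y)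
  rw [lintegral_const_mul _ hf, lintegral_const_mul _ hg, lintegral_const_mul _ hh] at normalized
  have hc (F a : ℝ≥0∞) (h0 : F ≠ 0) (ht : F ≠ ∞) : a = F * (F⁻¹ * a) := by
    rw [← mul_assoc, ENNReal.mul_inv_cancel h0 ht, one_mul]
  calc powMean l p (∫⁻ x, f x) (∫⁻ x, g x)
      = powMean l p (F * (F⁻¹ * ∫⁻ x, f x)) (G * (G⁻¹ * ∫⁻ x, g x)) := by
        rw [← hc F _ hF0 hfb, ← hc G _ hG0 hgb]
    _ ≤ _ := powMean_mul_le hl hp hF0 hfb hG0 hgb _ _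
    _ ≤ m * (m⁻¹ * ∫⁻ x, h x) := by gcongr
    _ = ∫⁻ x, h x := (hc m _ hm0 hmt).symm

theorem borellBrascampLieb_real {l p : ℝ} (hl : l ∈ Ioo (0 : ℝ) 1) (hp : 0 < p) :
    BorellBrascampLieb (volume : Measure ℝ) l (p + 1) p := by
  intro f g h hf hg hh hfgh
  have hp1 : 0 < p + 1 := by linarith
  have trunc (u : ℝ → ℝ≥0∞) (hu : Measurable u) :
      Filter.Tendsto (fun N : ℕ => ∫⁻ x, min (u x) N) Filter.atTop (nhds (∫⁻ x, u x)) := by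
    refine lintegral_tendsto_of_tendsto_of_monotone
      (fun N => (hu.min measurable_const).aemeasurable)
      (.of_forall fun x M N hMN => min_le_min le_rfl (by exact_mod_cast hMN))
      (.of_forall fun x => ?_)
    simpa using tendsto_const_nhds.min ENNReal.tendsto_nat_nhds_top
  have bdd (u : ℝ → ℝ≥0∞) (N : ℕ) : ⨆ x, min (u x) N ≠ ∞ :=
    ((iSup_le fun x => min_le_right _ _).trans_lt (ENNReal.natCast_lt_top N)).ne
  refine le_of_tendsto' ((continuous_powMean.tendsto _).comp
    ((trunc f hf).prodMk_nhds (trunc g hg))) fun N => ?_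
  exact powMean_lintegral_le_of_bounded hl hp (hf.min measurable_const)
    (hg.min measurable_const) hh (bdd f N) (bdd g N) fun x y =>
      (powMean_mono hp1 (min_le_left _ _) (min_le_left _ _)).trans (hfgh x y)

theorem BorellBrascampLieb.prod {E F : Type*} [MeasurableSpace E] [AddCommGroup E] [Module ℝ E]
    [MeasurableSpace F] [AddCommGroup F] [Module ℝ F] {μ : Measure E} {ν : Measure F}
    [SFinite ν] {l p q r : ℝ} (hν : BorellBrascampLieb ν l p q)
    (hμ : BorellBrascampLieb μ l q r) : BorellBrascampLieb (μ.prod ν) l p r := by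
  intro f g h hf hg hh hfgh
  rw [lintegral_prod _ hf.aemeasurable, lintegral_prod _ hg.aemeasurable,
    lintegral_prod _ hh.aemeasurable]
  exact hμ _ _ _ hf.lintegral_prod_right' hg.lintegral_prod_right' hh.lintegral_prod_right'
    fun x y => hν _ _ _ (hf.comp measurable_prodMk_left) (hg.comp measurable_prodMk_left)
      (hh.comp measurable_prodMk_left) fun u v => hfgh (x, u) (y, v)

theorem borellBrascampLieb_pi {l p : ℝ} (hl : l ∈ Ioo (0 : ℝ) 1) (hp : 0 < p) (n : ℕ) :
    BorellBrascampLieb (volume : Measure (Fin n → ℝ)) l (p + n) p := by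
  induction n with
  | zero =>
    intro f g h _ _ _ hfgh
    have lintegral_eq (u : (Fin 0 → ℝ) → ℝ≥0∞) : ∫⁻ x, u x = u default := by
      rw [lintegral_unique]
      simp only [volume_pi, Measure.pi_empty_univ, mul_one]
      exact congrArg u (Subsingleton.elim _ _)
    have h0 := hfgh default default
    rw [Nat.cast_zero, add_zero] at h0
    rw [lintegral_eq, lintegral_eq, lintegral_eq]
    exact h0.trans_eq (congrArg h (Subsingleton.elim _ _))
  | succ n ih =>
    intro f g h hf hg hh hfgh
    have hpn : p + (n + 1 : ℕ) = p + n + 1 := by push_cast; ring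
    rw [hpn] at hfgh
    have hprod := (borellBrascampLieb_real hl (p := p + n) (by positivity)).prod ih
    let e := (MeasurableEquiv.piFinSuccAbove (fun _ : Fin (n + 1) => ℝ) (Fin.last n)).trans
      MeasurableEquiv.prodComm
    have he : MeasurePreserving e.symm := by
      refine MeasurePreserving.symm e ?_
      exact Measure.measurePreserving_swap.comp
        (volume_preserving_piFinSuccAbove (fun _ : Fin (n + 1) => ℝ) (Fin.last n))
    have hlin (x y : (Fin n → ℝ) × ℝ) :
        e.symm ((1 - l) • x + l • y) = (1 - l) • e.symm x + l • e.symm y := by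
      refine e.injective ?_
      have he_lin (u v : Fin (n + 1) → ℝ) :
          e ((1 - l) • u + l • v) = (1 - l) • e u + l • e v := rfl
      simp only [he_lin, e.apply_symm_apply]
    rw [← he.lintegral_comp hf, ← he.lintegral_comp hg, ← he.lintegral_comp hh]
    exact hprod _ _ _ (hf.comp e.symm.measurable) (hg.comp e.symm.measurable)
      (hh.comp e.symm.measurable) fun x y => by rw [hlin]; exact hfgh _ _

lemma convex_mul_exp_inv {c l x y : ℝ} (hl : l ∈ Ioo (0 : ℝ) 1) (hx : 0 < x) (hy : 0 < y) :
    ((1 - l) * x + l * y) * Real.exp (c * ((1 - l) * x + l * y)⁻¹)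
      ≤ (1 - l) * (x * Real.exp (c * x⁻¹)) + l * (y * Real.exp (c * y⁻¹)) := by
  have h1 : 0 < 1 - l := by linarith [hl.2]
  have hl0 := hl.1
  set z := (1 - l) * x + l * y with hz
  have hz0 : 0 < z := by positivity
  have h := convexOn_exp.2 (mem_univ (c * x⁻¹)) (mem_univ (c * y⁻¹))
    (by positivity : 0 ≤ (1 - l) * x / z) (by positivity : 0 ≤ l * y / z)
    (by rw [← add_div, ← hz, div_self hz0.ne'])
  have he : ((1 - l) * x / z) • (c * x⁻¹) + (l * y / z) • (c * y⁻¹) = c * z⁻¹ := by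
    simp only [smul_eq_mul]
    field_simp
    ring
  rw [he, smul_eq_mul, smul_eq_mul] at h
  calc z * Real.exp (c * z⁻¹)
      ≤ z * ((1 - l) * x / z * Real.exp (c * x⁻¹) + l * y / z * Real.exp (c * y⁻¹)) := by
        gcongr
    _ = _ := by field_simp

lemma powMean_density_le {l q x y : ℝ} (hl : l ∈ Ioo (0 : ℝ) 1) (hq : 0 < q) (hx : 0 < x)
    (hy : 0 < y) :
    powMean l q (ENNReal.ofReal (Real.exp (-x⁻¹) * x ^ (-q)))
        (ENNReal.ofReal (Real.exp (-y⁻¹) * y ^ (-q)))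
      ≤ ENNReal.ofReal (Real.exp (-((1 - l) * x + l * y)⁻¹) * ((1 - l) * x + l * y) ^ (-q)) := by
  have h1 : 0 < 1 - l := by linarith [hl.2]
  have hl0 := hl.1
  have hpow (z : ℝ) (hz : 0 < z) :
      Real.exp (-z⁻¹) * z ^ (-q) = (z * Real.exp (q⁻¹ * z⁻¹)) ^ (-q) := by
    rw [Real.mul_rpow hz.le (Real.exp_pos _).le, ← Real.exp_mul, mul_comm]
    congr 2
    field_simp
  have hroot (z : ℝ) (hz : 0 < z) :
      ENNReal.ofReal (Real.exp (-z⁻¹) * z ^ (-q)) ^ (-q⁻¹)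
        = ENNReal.ofReal (z * Real.exp (q⁻¹ * z⁻¹)) := by
    have hz' : 0 < z * Real.exp (q⁻¹ * z⁻¹) := by positivity
    rw [hpow z hz, ENNReal.ofReal_rpow_of_pos (by positivity), ← Real.rpow_mul hz'.le,
      neg_mul_neg, mul_inv_cancel₀ hq.ne', Real.rpow_one]
  rw [powMean, hroot x hx, hroot y hy, ← ENNReal.ofReal_mul h1.le, ← ENNReal.ofReal_mul hl0.le,
    ← ENNReal.ofReal_add (by positivity) (by positivity),
    ENNReal.ofReal_rpow_of_pos (by positivity), hpow _ (by positivity)]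
  exact ENNReal.ofReal_le_ofReal (Real.rpow_le_rpow_of_nonpos (by positivity)
    (convex_mul_exp_inv hl hx hy) (by linarith))

/-- The measure `ν` on `ℝⁿ × (0,∞)` with density `e^{-1/z} z^{-(n+2)}` is
`(-1)`-concave. -/
theorem nu_neg_one_concave (n : ℕ)
    (ν : Measure ((Fin n → ℝ) × ℝ))
    (hν : ν = volume.withDensity (fun p =>
      if 0 < p.2 then ENNReal.ofReal (Real.exp (-p.2⁻¹) * p.2 ^ (-(n + 2 : ℝ))) else 0))
    (A B : Set ((Fin n → ℝ) × ℝ))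
    (hA : MeasurableSet A) (hB : MeasurableSet B)
    (hA0 : A.Nonempty) (hB0 : B.Nonempty)
    (hAz : ∀ p ∈ A, 0 < p.2) (hBz : ∀ p ∈ B, 0 < p.2)
    (hAν : 0 < ν A) (hBν : 0 < ν B)
    (l : ℝ) (hl : l ∈ Set.Ioo (0 : ℝ) 1) :
    (ENNReal.ofReal (1 - l) * (ν A)⁻¹ + ENNReal.ofReal l * (ν B)⁻¹)⁻¹
      ≤ ν ((1 - l) • A + l • B) := by
  set ρ : (Fin n → ℝ) × ℝ → ℝ≥0∞ := fun p =>
    if 0 < p.2 then ENNReal.ofReal (Real.exp (-p.2⁻¹) * p.2 ^ (-(n + 2 : ℝ))) else 0 with hρ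
  have hρm : Measurable ρ :=
    Measurable.ite (measurableSet_lt measurable_const measurable_snd) (by fun_prop)
      measurable_const
  set D := toMeasurable ν ((1 - l) • A + l • B)
  have hD : MeasurableSet D := measurableSet_toMeasurable _ _
  have hνS (S : Set ((Fin n → ℝ) × ℝ)) (hS : MeasurableSet S) :
      ν S = ∫⁻ x, S.indicator ρ x := by
    rw [hν, withDensity_apply _ hS, lintegral_indicator hS]
  have hq : (0 : ℝ) < n + 2 := by positivity
  have hBBL : BorellBrascampLieb (volume : Measure ((Fin n → ℝ) × ℝ)) l (1 + n + 1) 1 :=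
    (borellBrascampLieb_real hl (by positivity)).prod (borellBrascampLieb_pi hl one_pos n)
  have key := hBBL _ _ _ (hρm.indicator hA) (hρm.indicator hB) (hρm.indicator hD) ?_
  · rw [← hνS A hA, ← hνS B hB, ← hνS D hD, measure_toMeasurable] at key
    simpa [powMean, ENNReal.rpow_neg_one] using key
  · intro x y
    rw [show (1 + n + 1 : ℝ) = n + 2 by ring]
    by_cases hx : x ∈ A
    · by_cases hy : y ∈ B
      · have hx0 := hAz x hx
        have hy0 := hBz y hy
        have h1 : 0 < 1 - l := by linarith [hl.2]
        have hl0 := hl.1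
        have hz : 0 < (1 - l) * x.2 + l * y.2 := by positivity
        have hmem : (1 - l) • x + l • y ∈ D :=
          subset_toMeasurable _ _ (add_mem_add (smul_mem_smul_set hx) (smul_mem_smul_set hy))
        rw [indicator_of_mem hx, indicator_of_mem hy, indicator_of_mem hmem]
        simpa [hρ, hx0, hy0, hz] using powMean_density_le hl hq hx0 hy0
      · simp [indicator_of_notMem hy, powMean_zero_right hl.1 hq]
    · simp [indicator_of_notMem hx, powMean_zero_left hl.2 hq]
end

section
/- Prékopa–Leindler via Borell: the measure μ on ℝⁿ × ℝ with density e^{−z} dz dx is log-concave, and consequently for any φ, ψ : ℝⁿ → (−∞, ∞] and λ ∈ (0,1), ∫ e^{−(φ □_λ ψ)} ≥ (∫ e^{−φ})^{1−λ} (∫ e^{−ψ})^{λ}, where φ □_λ ψ is the function whose strict epigraph equals (1−λ)·epi(φ) + λ·epi(ψ) (with the left integral interpreted as outer integral if needed). -/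
open MeasureTheory Set Pointwise
open scoped ENNReal

/-- Strict epigraph of an extended-real-valued function, as a subset of `ℝⁿ × ℝ`. -/
def epiE {n : ℕ} (φ : (Fin n → ℝ) → EReal) : Set ((Fin n → ℝ) × ℝ) :=
  {p | φ p.1 < (p.2 : EReal)}

/-- `e^{-a}` for `a ∈ (-∞,∞]`, with `e^{-∞} = 0`. -/
noncomputable def negExpE (a : EReal) : ENNReal :=
  if a = ⊤ then 0 else ENNReal.ofReal (Real.exp (-a.toReal))

theorem exists_volume_inter_Ioi_le {A : Set ℝ} (hA : BddAbove A) (hne : A.Nonempty) {ε : ℝ}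
    (hε : 0 < ε) : ∃ a ∈ A, volume (A ∩ Ioi a) ≤ ENNReal.ofReal ε := by
  obtain ⟨a, ha, hlt⟩ := exists_lt_of_lt_csSup hne (sub_lt_self (sSup A) hε)
  refine ⟨a, ha, (measure_mono (t := Ioc a (sSup A))
    fun x hx => ⟨hx.2, le_csSup hA hx.1⟩).trans ?_⟩
  rw [Real.volume_Ioc]
  exact ENNReal.ofReal_le_ofReal (by linarith)

theorem exists_volume_inter_Iio_le {A : Set ℝ} (hA : BddBelow A) (hne : A.Nonempty) {ε : ℝ}
    (hε : 0 < ε) : ∃ a ∈ A, volume (A ∩ Iio a) ≤ ENNReal.ofReal ε := by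
  obtain ⟨a, ha, hlt⟩ := exists_lt_of_csInf_lt hne (lt_add_of_pos_right (sInf A) hε)
  refine ⟨a, ha, (measure_mono (t := Ico (sInf A) a)
    fun x hx => ⟨csInf_le hA hx.1, hx.2⟩).trans ?_⟩
  rw [Real.volume_Ico]
  exact ENNReal.ofReal_le_ofReal (by linarith)

theorem volume_preimage_mul_add {r : ℝ} (hr : 0 < r) (c : ℝ) (s : Set ℝ) :
    ENNReal.ofReal r * volume ((fun x => r * x + c) ⁻¹' s) = volume s := by
  have h : (fun x => r * x + c) ⁻¹' s = (r * ·) ⁻¹' ((· + c) ⁻¹' s) := rfl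
  rw [h, Real.volume_preimage_mul_left hr.ne', measure_preimage_add_right, abs_of_pos (by positivity),
    ← mul_assoc, ← ENNReal.ofReal_mul hr.le, mul_inv_cancel₀ hr.ne', ENNReal.ofReal_one, one_mul]

theorem brunnMinkowski_real_of_bounded {A B C : Set ℝ} (hA : Bornology.IsBounded A)
    (hB : Bornology.IsBounded B)
    (hA0 : volume A ≠ 0) (hB0 : volume B ≠ 0) {l : ℝ} (hl : l ∈ Ioo (0 : ℝ) 1)
    (h : ∀ᵐ p : ℝ × ℝ ∂(volume.prod volume),
      p.1 ∈ A → p.2 ∈ B → (1 - l) * p.1 + l * p.2 ∈ C) :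
    ENNReal.ofReal (1 - l) * volume A + ENNReal.ofReal l * volume B ≤ volume C := by
  have hl1 : 0 < 1 - l := by linarith [hl.2]
  have h1 := Measure.ae_ae_of_ae_prod h
  have h2 := Measure.ae_ae_of_ae_prod (Measure.measurePreserving_swap.quasiMeasurePreserving.ae h)
  simp only [Prod.fst_swap, Prod.snd_swap] at h2
  set G := {x | ∀ᵐ y, x ∈ A → y ∈ B → (1 - l) * x + l * y ∈ C}
  set K := {y | ∀ᵐ x, x ∈ A → y ∈ B → (1 - l) * x + l * y ∈ C}
  have hAG : volume (A ∩ G) = volume A := measure_inter_conull'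
    (measure_mono_null (fun _ hx => hx.2) (mem_ae_iff.1 h1))
  have hBK : volume (B ∩ K) = volume B := measure_inter_conull'
    (measure_mono_null (fun _ hx => hx.2) (mem_ae_iff.1 h2))
  refine ENNReal.le_of_forall_pos_le_add fun ε hε _ => ?_
  obtain ⟨a, ha, haε⟩ := exists_volume_inter_Ioi_le (A := A ∩ G)
    (hA.bddAbove.mono inter_subset_left) (nonempty_of_measure_ne_zero (hAG ▸ hA0)) (ε := ε) hε
  obtain ⟨b, hb, hbε⟩ := exists_volume_inter_Iio_le (A := B ∩ K)
    (hB.bddBelow.mono inter_subset_left) (nonempty_of_measure_ne_zero (hBK ▸ hB0)) (ε := ε) hε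
  set m := (1 - l) * a + l * b
  have hA1 : volume A ≤ volume ((fun x => (1 - l) * x + l * b) ⁻¹' (C ∩ Iic m)) + ε := by
    rw [← hAG, ← ENNReal.ofReal_coe_nnreal]
    refine le_trans ?_ (add_le_add_right haε _)
    refine (measure_le_inter_add_sdiff volume (A ∩ G) (Iic a)).trans
      (add_le_add ?_ (measure_mono ?_))
    · refine measure_mono_ae ?_
      filter_upwards [hb.2] with x hx hxA
      refine ⟨hx hxA.1.1 hb.1, ?_⟩
      have : x ≤ a := hxA.2
      simp only [mem_Iic, m]; gcongr
    · rintro x ⟨hx, hxa⟩; exact ⟨hx, by simpa using hxa⟩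
  have hB1 : volume B ≤ volume ((fun x => l * x + (1 - l) * a) ⁻¹' (C ∩ Ici m)) + ε := by
    rw [← hBK, ← ENNReal.ofReal_coe_nnreal]
    refine le_trans ?_ (add_le_add_right hbε _)
    refine (measure_le_inter_add_sdiff volume (B ∩ K) (Ici b)).trans
      (add_le_add ?_ (measure_mono ?_))
    · refine measure_mono_ae ?_
      filter_upwards [ha.2] with x hx hxB
      refine ⟨by simpa only [add_comm] using hx ha.1 hxB.1.1, ?_⟩
      have : b ≤ x := hxB.2
      have := hl.1
      simp only [mem_Ici, m]; rw [add_comm]; gcongr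
    · rintro x ⟨hx, hxa⟩; exact ⟨hx, by simpa using hxa⟩
  have hsum : volume (C ∩ Iic m) + volume (C ∩ Ici m) = volume C := by
    rw [← measure_inter_add_sdiff C (measurableSet_Iic (a := m))]
    congr 1
    refine measure_congr ?_
    have : C \ Iic m = C ∩ Ioi m := by rw [sdiff_eq, compl_Iic]
    rw [this]
    exact (ae_eq_refl C).inter Ioi_ae_eq_Ici.symm
  calc ENNReal.ofReal (1 - l) * volume A + ENNReal.ofReal l * volume B
      ≤ ENNReal.ofReal (1 - l) * (volume ((fun x => (1 - l) * x + l * b) ⁻¹' (C ∩ Iic m)) + ε)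
        + ENNReal.ofReal l * (volume ((fun x => l * x + (1 - l) * a) ⁻¹' (C ∩ Ici m)) + ε) := by
        gcongr
    _ = volume C + (ENNReal.ofReal (1 - l) + ENNReal.ofReal l) * ε := by
        rw [mul_add, mul_add, volume_preimage_mul_add hl1, volume_preimage_mul_add hl.1, ← hsum]
        ring
    _ = volume C + ε := by
        rw [← ENNReal.ofReal_add hl1.le hl.1.le]; simp

theorem brunnMinkowski_real {A B C : Set ℝ}
    (hA0 : volume A ≠ 0) (hB0 : volume B ≠ 0) {l : ℝ} (hl : l ∈ Ioo (0 : ℝ) 1)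
    (h : ∀ᵐ p : ℝ × ℝ ∂(volume.prod volume),
      p.1 ∈ A → p.2 ∈ B → (1 - l) * p.1 + l * p.2 ∈ C) :
    ENNReal.ofReal (1 - l) * volume A + ENNReal.ofReal l * volume B ≤ volume C := by
  have key (S : Set ℝ) : Filter.Tendsto (fun k : ℕ => volume (S ∩ Metric.closedBall 0 k))
      Filter.atTop (nhds (volume S)) := by
    have := tendsto_measure_iUnion_atTop (μ := volume)
      (s := fun k : ℕ => S ∩ Metric.closedBall (0 : ℝ) k)
      fun i j hij => inter_subset_inter_right _ (Metric.closedBall_subset_closedBall (by simpa))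
    rwa [← inter_iUnion, Metric.iUnion_closedBall_nat, inter_univ] at this
  refine le_of_tendsto ((ENNReal.Tendsto.const_mul (key A) (Or.inr ENNReal.ofReal_ne_top)).add
    (ENNReal.Tendsto.const_mul (key B) (Or.inr ENNReal.ofReal_ne_top))) ?_
  filter_upwards [(key A).eventually_ne hA0, (key B).eventually_ne hB0] with k hkA hkB
  refine brunnMinkowski_real_of_bounded (Metric.isBounded_closedBall.subset inter_subset_right)
    (Metric.isBounded_closedBall.subset inter_subset_right) hkA hkB hl ?_
  filter_upwards [h] with p hp h1 h2 using hp h1.1 h2.1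

theorem ENNReal.geom_mean_le_arith_mean {l : ℝ} (hl : l ∈ Ioo (0 : ℝ) 1) (a b : ℝ≥0∞) :
    a ^ (1 - l) * b ^ l ≤ ENNReal.ofReal (1 - l) * a + ENNReal.ofReal l * b := by
  have hl1 : 0 < 1 - l := by linarith [hl.2]
  rcases eq_or_ne a ⊤ with rfl | ha
  · simp [ENNReal.mul_top, hl.2]
  rcases eq_or_ne b ⊤ with rfl | hb
  · simp [ENNReal.mul_top, hl.1]
  lift a to NNReal using ha
  lift b to NNReal using hb
  have := NNReal.geom_mean_le_arith_mean2_weighted (1 - l).toNNReal l.toNNReal a b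
    (by rw [← Real.toNNReal_add hl1.le hl.1.le]; simp)
  rw [Real.coe_toNNReal _ hl1.le, Real.coe_toNNReal _ hl.1.le] at this
  rw [← ENNReal.coe_rpow_of_nonneg _ hl1.le, ← ENNReal.coe_rpow_of_nonneg _ hl.1.le]
  rw [ENNReal.ofReal, ENNReal.ofReal]
  exact_mod_cast this

theorem lintegral_arith_mean_le_of_normalized {f g h : ℝ → ℝ} (hf : Measurable f)
    (hg : Measurable g) (hh : Measurable h) (hf0 : ∀ x, f x ∈ Icc 0 1) (hg0 : ∀ x, g x ∈ Icc 0 1)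
    (hh0 : ∀ x, 0 ≤ h x)
    (hfs : ∀ t ∈ Ioo (0 : ℝ) 1, volume {x | t < f x} ≠ 0)
    (hgs : ∀ t ∈ Ioo (0 : ℝ) 1, volume {x | t < g x} ≠ 0)
    {l : ℝ} (hl : l ∈ Ioo (0 : ℝ) 1)
    (H : ∀ᵐ p : ℝ × ℝ ∂(volume.prod volume),
      f p.1 ^ (1 - l) * g p.2 ^ l ≤ h ((1 - l) * p.1 + l * p.2)) :
    ENNReal.ofReal (1 - l) * (∫⁻ x, ENNReal.ofReal (f x)) +
      ENNReal.ofReal l * (∫⁻ x, ENNReal.ofReal (g x)) ≤ ∫⁻ x, ENNReal.ofReal (h x) := by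
  have hl1 : 0 < 1 - l := by linarith [hl.2]
  rw [lintegral_eq_lintegral_meas_lt volume (ae_of_all _ fun x => (hf0 x).1) hf.aemeasurable,
    lintegral_eq_lintegral_meas_lt volume (ae_of_all _ fun x => (hg0 x).1) hg.aemeasurable,
    lintegral_eq_lintegral_meas_lt volume (ae_of_all _ hh0) hh.aemeasurable,
    ← lintegral_const_mul' _ _ ENNReal.ofReal_ne_top,
    ← lintegral_const_mul' _ _ ENNReal.ofReal_ne_top]
  refine (le_lintegral_add _ _).trans (setLIntegral_mono_ae' measurableSet_Ioi
    (ae_of_all _ fun t ht => ?_))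
  have ht0 : 0 < t := ht
  rcases lt_or_ge t 1 with h1 | h1
  · refine brunnMinkowski_real (hfs t ⟨ht, h1⟩)
      (hgs t ⟨ht, h1⟩) hl ?_
    filter_upwards [H] with p hp hpf hpg
    refine lt_of_lt_of_le ?_ hp
    calc t = t ^ (1 - l) * t ^ l := by rw [← Real.rpow_add ht0]; simp
      _ < _ := mul_lt_mul'' (Real.rpow_lt_rpow ht0.le hpf hl1) (Real.rpow_lt_rpow ht0.le hpg hl.1)
        (by positivity) (by positivity)
  · have e1 : {x | t < f x} = ∅ := by ext x; simpa using (hf0 x).2.trans h1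
    have e2 : {x | t < g x} = ∅ := by ext x; simpa using (hg0 x).2.trans h1
    simp [e1, e2]

theorem ENNReal.rpow_iSup_mul_le {ι : Type*} {a : ι → ℝ≥0∞} {r : ℝ} (hr : 0 < r) {c d : ℝ≥0∞}
    (h : ∀ i, a i ^ r * c ≤ d) : (⨆ i, a i) ^ r * c ≤ d := by
  have := (ENNReal.orderIsoRpow r hr).map_iSup a
  simp only [ENNReal.orderIsoRpow_apply] at this
  rw [this, ENNReal.iSup_mul]
  exact iSup_le h

theorem lintegral_eq_iSup_min_natCast {α : Type*} [MeasurableSpace α] {ν : Measure α}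
    {f : α → ℝ≥0∞} (hf : Measurable f) :
    ∫⁻ x, f x ∂ν = ⨆ k : ℕ, ∫⁻ x, min (f x) k ∂ν := by
  rw [← lintegral_iSup (fun k => hf.min measurable_const)
    fun i j hij x => min_le_min le_rfl (by exact_mod_cast hij)]
  congr 1 with x
  rw [← inf_iSup_eq, ENNReal.iSup_natCast, inf_top_eq]

/-- The Prékopa–Leindler inequality for a measure, in its essential form: the hypothesis is only
required almost everywhere. -/
def SatisfiesPrekopaLeindler {E : Type*} [AddCommGroup E] [Module ℝ E] [MeasurableSpace E]
    (ν : Measure E) : Prop :=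
  ∀ l ∈ Ioo (0 : ℝ) 1, ∀ f g h : E → ℝ≥0∞, Measurable f → Measurable g → Measurable h →
    (∀ᵐ p : E × E ∂(ν.prod ν), f p.1 ^ (1 - l) * g p.2 ^ l ≤ h ((1 - l) • p.1 + l • p.2)) →
    (∫⁻ x, f x ∂ν) ^ (1 - l) * (∫⁻ x, g x ∂ν) ^ l ≤ ∫⁻ x, h x ∂ν

/-- The function `f` rescaled to have essential supremum `1`, as a real-valued function. -/
noncomputable def essNormalize (f : ℝ → ℝ≥0∞) (x : ℝ) : ℝ :=
  (min (f x / essSup f volume) 1).toReal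

section essNormalize

variable {f : ℝ → ℝ≥0∞}

theorem measurable_essNormalize (hf : Measurable f) : Measurable (essNormalize f) :=
  ((hf.div_const _).min measurable_const).ennreal_toReal

theorem ofReal_essNormalize (x : ℝ) :
    ENNReal.ofReal (essNormalize f x) = min (f x / essSup f volume) 1 :=
  ENNReal.ofReal_toReal (by simp)

theorem essNormalize_mem_Icc (x : ℝ) : essNormalize f x ∈ Icc (0 : ℝ) 1 :=
  ⟨ENNReal.toReal_nonneg, ENNReal.toReal_le_of_le_ofReal zero_le_one (by simp)⟩

theorem volume_lt_essNormalize_ne_zero (h0 : essSup f volume ≠ 0) (htop : essSup f volume ≠ ⊤)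
    {t : ℝ} (ht : t ∈ Ioo (0 : ℝ) 1) : volume {x | t < essNormalize f x} ≠ 0 := by
  intro hvol
  have hle : essSup f volume ≤ ENNReal.ofReal t * essSup f volume := by
    refine essSup_le_of_ae_le _ ?_
    filter_upwards [measure_eq_zero_iff_ae_notMem.1 hvol] with x hx
    have hx' := ENNReal.ofReal_le_ofReal (not_lt.1 hx)
    rw [ofReal_essNormalize, min_le_iff] at hx'
    rcases hx' with hx' | hx'
    · exact (ENNReal.div_le_iff h0 htop).1 hx'
    · exact absurd hx' (not_le.2 (ENNReal.ofReal_lt_one.2 ht.2))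
  refine absurd hle (not_le.2 ?_)
  conv_rhs => rw [← one_mul (essSup f volume)]
  exact ENNReal.mul_lt_mul_left h0 htop (ENNReal.ofReal_lt_one.2 ht.2)

theorem lintegral_eq_essSup_mul_essNormalize (hf : Measurable f)
    (h0 : essSup f volume ≠ 0) (htop : essSup f volume ≠ ⊤) :
    ∫⁻ x, f x = essSup f volume * ∫⁻ x, ENNReal.ofReal (essNormalize f x) := by
  rw [← lintegral_const_mul _ (measurable_essNormalize hf).ennreal_ofReal]
  refine lintegral_congr_ae ?_
  filter_upwards [ENNReal.ae_le_essSup f] with x hx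
  rw [ofReal_essNormalize, min_eq_left (ENNReal.div_le_of_le_mul (by simpa using hx)),
    ENNReal.mul_div_cancel h0 htop]

end essNormalize

theorem prekopaLeindler_real_of_essSup_ne_top {l : ℝ} (hl : l ∈ Ioo (0 : ℝ) 1)
    {f g h : ℝ → ℝ≥0∞} (hf : Measurable f) (hg : Measurable g) (hh : Measurable h)
    (hfT : essSup f volume ≠ ⊤) (hgT : essSup g volume ≠ ⊤)
    (H : ∀ᵐ p : ℝ × ℝ ∂(volume.prod volume),
      f p.1 ^ (1 - l) * g p.2 ^ l ≤ h ((1 - l) * p.1 + l * p.2)) :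
    (∫⁻ x, f x) ^ (1 - l) * (∫⁻ x, g x) ^ l ≤ ∫⁻ x, h x := by
  have hl0 : 0 < l := hl.1
  have hl1 : 0 < 1 - l := by linarith [hl.2]
  rcases eq_or_ne (essSup f volume) 0 with hf0 | hf0
  · simp [lintegral_congr_ae (ENNReal.essSup_eq_zero_iff.1 hf0), hl1]
  rcases eq_or_ne (essSup g volume) 0 with hg0 | hg0
  · simp [lintegral_congr_ae (ENNReal.essSup_eq_zero_iff.1 hg0), hl0]
  set p := essSup f volume
  set q := essSup g volume
  set c := p ^ (1 - l) * q ^ l with hc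
  have hp0 : p ^ (1 - l) ≠ 0 := by simp [hf0, hfT]
  have hq0 : q ^ l ≠ 0 := by simp [hg0, hgT]
  have hpT : p ^ (1 - l) ≠ ⊤ := ENNReal.rpow_ne_top_of_nonneg hl1.le hfT
  have hqT : q ^ l ≠ ⊤ := ENNReal.rpow_ne_top_of_nonneg hl0.le hgT
  have hc0 : c ≠ 0 := mul_ne_zero hp0 hq0
  have hcT : c ≠ ⊤ := ENNReal.mul_ne_top hpT hqT
  have key := lintegral_arith_mean_le_of_normalized (measurable_essNormalize hf)
    (measurable_essNormalize hg)
    (h := fun x => (min (h x / c) 1).toReal)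
    ((hh.div_const _).min measurable_const).ennreal_toReal
    essNormalize_mem_Icc essNormalize_mem_Icc (fun _ => ENNReal.toReal_nonneg)
    (fun t => volume_lt_essNormalize_ne_zero hf0 hfT)
    (fun t => volume_lt_essNormalize_ne_zero hg0 hgT) hl ?_
  · calc (∫⁻ x, f x) ^ (1 - l) * (∫⁻ x, g x) ^ l
        = c * ((∫⁻ x, ENNReal.ofReal (essNormalize f x)) ^ (1 - l) *
            (∫⁻ x, ENNReal.ofReal (essNormalize g x)) ^ l) := by
          rw [lintegral_eq_essSup_mul_essNormalize hf hf0 hfT,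
            lintegral_eq_essSup_mul_essNormalize hg hg0 hgT,
            ENNReal.mul_rpow_of_nonneg _ _ hl1.le, ENNReal.mul_rpow_of_nonneg _ _ hl0.le,
            mul_mul_mul_comm]
      _ ≤ c * ∫⁻ x, ENNReal.ofReal ((min (h x / c) 1).toReal) := by
          gcongr
          exact (ENNReal.geom_mean_le_arith_mean hl _ _).trans key
      _ ≤ c * ∫⁻ x, h x / c := by
          gcongr with x
          exact ENNReal.ofReal_toReal_le.trans (min_le_left _ _)
      _ = ∫⁻ x, h x := by
          rw [← lintegral_const_mul _ (hh.div_const _)]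
          simp [ENNReal.mul_div_cancel hc0 hcT]
  · filter_upwards [H] with z hz
    simp only [essNormalize]
    rw [ENNReal.toReal_rpow, ENNReal.toReal_rpow, ← ENNReal.toReal_mul]
    refine ENNReal.toReal_mono (by simp) (le_min ?_ ?_)
    · calc _ ≤ (f z.1 / p) ^ (1 - l) * (g z.2 / q) ^ l := by
            gcongr <;> exact min_le_left _ _
        _ = f z.1 ^ (1 - l) * g z.2 ^ l / c := by
            rw [ENNReal.div_rpow_of_nonneg _ _ hl1.le, ENNReal.div_rpow_of_nonneg _ _ hl0.le,
              div_eq_mul_inv, div_eq_mul_inv, div_eq_mul_inv, hc,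
              ENNReal.mul_inv (Or.inl hp0) (Or.inl hpT), mul_mul_mul_comm]
        _ ≤ _ := by gcongr
    · exact mul_le_one' (ENNReal.rpow_le_one (min_le_right _ _) hl1.le)
        (ENNReal.rpow_le_one (min_le_right _ _) hl0.le)

theorem satisfiesPrekopaLeindler_real : SatisfiesPrekopaLeindler (volume : Measure ℝ) := by
  intro l hl f g h hf hg hh H
  have hl0 : 0 < l := hl.1
  have hl1 : 0 < 1 - l := by linarith [hl.2]
  have hfin (u : ℝ → ℝ≥0∞) (k : ℕ) : essSup (fun x => min (u x) k) volume ≠ ⊤ :=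
    ne_top_of_le_ne_top (ENNReal.natCast_ne_top k)
      (essSup_le_of_ae_le _ (ae_of_all _ fun x => min_le_right _ _))
  rw [lintegral_eq_iSup_min_natCast hf, lintegral_eq_iSup_min_natCast hg]
  refine ENNReal.rpow_iSup_mul_le hl1 fun i => ?_
  rw [mul_comm]
  refine ENNReal.rpow_iSup_mul_le hl0 fun j => ?_
  rw [mul_comm]
  refine prekopaLeindler_real_of_essSup_ne_top hl (hf.min measurable_const)
    (hg.min measurable_const) hh (hfin f i) (hfin g j) ?_
  filter_upwards [H] with p hp
  refine le_trans ?_ hp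
  gcongr <;> exact min_le_left _ _

theorem measurePreserving_prodProdProdComm {E F : Type*} [MeasurableSpace E] [MeasurableSpace F]
    (ν : Measure E) (ρ : Measure F) [SigmaFinite ν] [SigmaFinite ρ] :
    MeasurePreserving (fun p : (E × E) × (F × F) => ((p.1.1, p.2.1), (p.1.2, p.2.2)))
      ((ν.prod ν).prod (ρ.prod ρ)) ((ν.prod ρ).prod (ν.prod ρ)) := by
  have h1 := measurePreserving_prodAssoc ν ν (ρ.prod ρ)
  have h2 := (MeasurePreserving.id ν).prod (measurePreserving_prodAssoc ν ρ ρ).symm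
  have h3 := (MeasurePreserving.id ν).prod
    ((Measure.measurePreserving_swap (μ := ν) (ν := ρ)).prod (MeasurePreserving.id ρ))
  have h4 := (MeasurePreserving.id ν).prod (measurePreserving_prodAssoc ρ ν ρ)
  have h5 := (measurePreserving_prodAssoc ν ρ (ν.prod ρ)).symm
  exact h5.comp (h4.comp (h3.comp (h2.comp h1)))

theorem SatisfiesPrekopaLeindler.prod {E F : Type*} [AddCommGroup E] [Module ℝ E]
    [MeasurableSpace E] [AddCommGroup F] [Module ℝ F] [MeasurableSpace F]
    {ν : Measure E} {ρ : Measure F} [SigmaFinite ν] [SigmaFinite ρ]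
    (hν : SatisfiesPrekopaLeindler ν) (hρ : SatisfiesPrekopaLeindler ρ) :
    SatisfiesPrekopaLeindler (ν.prod ρ) := by
  intro l hl f g h hf hg hh H
  rw [lintegral_prod _ hf.aemeasurable, lintegral_prod _ hg.aemeasurable,
    lintegral_prod _ hh.aemeasurable]
  refine hν l hl _ _ _ hf.lintegral_prod_right' hg.lintegral_prod_right'
    hh.lintegral_prod_right' ?_
  have H' := Measure.ae_ae_of_ae_prod
    ((measurePreserving_prodProdProdComm ν ρ).quasiMeasurePreserving.ae H)
  filter_upwards [H'] with p hp
  exact hρ l hl _ _ _ (hf.comp measurable_prodMk_left) (hg.comp measurable_prodMk_left)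
    (hh.comp measurable_prodMk_left) hp

theorem SatisfiesPrekopaLeindler.of_measurePreserving {E F : Type*} [AddCommGroup E] [Module ℝ E]
    [MeasurableSpace E] [AddCommGroup F] [Module ℝ F] [MeasurableSpace F]
    {ν : Measure E} {ρ : Measure F} [SFinite ν] [SFinite ρ]
    (hν : SatisfiesPrekopaLeindler ν) (e : E →ₗ[ℝ] F)
    (he : MeasurePreserving e ν ρ) : SatisfiesPrekopaLeindler ρ := by
  intro l hl f g h hf hg hh H
  rw [← he.lintegral_comp hf, ← he.lintegral_comp hg, ← he.lintegral_comp hh]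
  refine hν l hl _ _ _ (hf.comp he.measurable) (hg.comp he.measurable) (hh.comp he.measurable) ?_
  filter_upwards [(he.prod he).quasiMeasurePreserving.ae H] with p hp
  simpa using hp

theorem satisfiesPrekopaLeindler_pi (n : ℕ) :
    SatisfiesPrekopaLeindler (volume : Measure (Fin n → ℝ)) := by
  induction n with
  | zero =>
    intro l hl f g h hf hg hh H
    rw [volume_pi, Measure.pi_of_empty _ 0, Measure.dirac_prod_dirac, ae_dirac_eq] at *
    simpa using H
  | succ n ih =>
    refine (satisfiesPrekopaLeindler_real.prod ih).of_measurePreserving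
      (Fin.consLinearEquiv ℝ (fun _ : Fin (n + 1) => ℝ)).toLinearMap ?_
    have heq : ⇑(Fin.consLinearEquiv ℝ (fun _ : Fin (n + 1) => ℝ)).toLinearMap =
        (MeasurableEquiv.piFinSuccAbove (fun _ : Fin (n + 1) => ℝ) 0).symm := by
      ext p i
      simp [MeasurableEquiv.piFinSuccAbove]
    rw [heq]
    exact (volume_preserving_piFinSuccAbove (fun _ : Fin (n + 1) => ℝ) 0).symm

theorem ae_prod_toMeasurable {E F : Type*} [MeasurableSpace E] [MeasurableSpace F]
    {ν : Measure E} {ρ : Measure F} [SFinite ν] [SFinite ρ] {A : Set E} {B : Set F}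
    {Q : Set (E × F)} (hQ : MeasurableSet Q) (h : A ×ˢ B ⊆ Q) :
    ∀ᵐ p ∂(ν.prod ρ), p.1 ∈ toMeasurable ν A → p.2 ∈ toMeasurable ρ B → p ∈ Q := by
  set S : Set (E × F) := (univ ×ˢ toMeasurable ρ B) ∩ Qᶜ with hS
  have hSm : MeasurableSet S :=
    (MeasurableSet.univ.prod (measurableSet_toMeasurable ρ B)).inter hQ.compl
  have hsec (x : E) : Prod.mk x ⁻¹' S = toMeasurable ρ B ∩ (Prod.mk x ⁻¹' Q)ᶜ := by
    ext y; simp [hS]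
  have hDm : MeasurableSet {x | ρ (Prod.mk x ⁻¹' S) ≠ 0} :=
    (measurable_measure_prodMk_left hSm (measurableSet_singleton 0)).compl
  have hA : A ∩ {x | ρ (Prod.mk x ⁻¹' S) ≠ 0} = ∅ := by
    refine eq_empty_of_forall_notMem fun x ⟨hxA, hx⟩ => hx ?_
    rw [hsec, Measure.measure_toMeasurable_inter_of_sFinite (measurable_prodMk_left hQ).compl]
    convert measure_empty (μ := ρ)
    exact eq_empty_of_forall_notMem fun y ⟨hyB, hy⟩ => hy (h ⟨hxA, hyB⟩)
  have hnull : ν (toMeasurable ν A ∩ {x | ρ (Prod.mk x ⁻¹' S) ≠ 0}) = 0 := by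
    rw [Measure.measure_toMeasurable_inter_of_sFinite hDm, hA, measure_empty]
  have hzero : (ν.prod ρ) ((toMeasurable ν A ×ˢ univ) ∩ S) = 0 := by
    rw [Measure.measure_prod_null
      (((measurableSet_toMeasurable ν A).prod MeasurableSet.univ).inter hSm)]
    filter_upwards [measure_eq_zero_iff_ae_notMem.1 hnull] with x hx
    by_cases hxA : x ∈ toMeasurable ν A
    · have : ρ (Prod.mk x ⁻¹' S) = 0 := by by_contra hne; exact hx ⟨hxA, hne⟩
      exact measure_mono_null (preimage_mono inter_subset_right) this
    · have : Prod.mk x ⁻¹' (toMeasurable ν A ×ˢ univ ∩ S) = ∅ := by ext y; simp [hxA]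
      simp [this]
  filter_upwards [measure_eq_zero_iff_ae_notMem.1 hzero] with p hp h1 h2
  by_contra hpQ
  exact hp ⟨⟨h1, mem_univ _⟩, ⟨mem_univ _, h2⟩, hpQ⟩

/-- **Borell's theorem**: a measure with log-concave density is log-concave, for arbitrary sets
and outer measures. -/
theorem SatisfiesPrekopaLeindler.withDensity {E : Type*} [AddCommGroup E] [Module ℝ E]
    [MeasurableSpace E] [MeasurableAdd₂ E] [MeasurableConstSMul ℝ E] {ν : Measure E} [SFinite ν]
    (hν : SatisfiesPrekopaLeindler ν) {w : E → ℝ≥0∞} (hw : Measurable w) {l : ℝ}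
    (hl : l ∈ Ioo (0 : ℝ) 1)
    (hconc : ∀ x y, w x ^ (1 - l) * w y ^ l ≤ w ((1 - l) • x + l • y)) (A B : Set E) :
    ν.withDensity w A ^ (1 - l) * ν.withDensity w B ^ l ≤
      ν.withDensity w ((1 - l) • A + l • B) := by
  have hl0 : 0 < l := hl.1
  have hl1 : 0 < 1 - l := by linarith [hl.2]
  set C := toMeasurable (ν.withDensity w) ((1 - l) • A + l • B) with hC
  have hCm : MeasurableSet C := measurableSet_toMeasurable _ _
  have hAm := measurableSet_toMeasurable ν A
  have hBm := measurableSet_toMeasurable ν B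
  have hQ : MeasurableSet {p : E × E | (1 - l) • p.1 + l • p.2 ∈ C} :=
    ((measurable_fst.const_smul (1 - l)).add (measurable_snd.const_smul l)) hCm
  have hsub : A ×ˢ B ⊆ {p : E × E | (1 - l) • p.1 + l • p.2 ∈ C} := fun p hp =>
    subset_toMeasurable _ _ (add_mem_add (smul_mem_smul_set hp.1) (smul_mem_smul_set hp.2))
  have hwi {s : Set E} (hs : MeasurableSet s) :
      ν.withDensity w s = ∫⁻ x, s.indicator w x ∂ν := by
    rw [withDensity_apply _ hs, lintegral_indicator hs]
  rw [← measure_toMeasurable ((1 - l) • A + l • B), ← hC]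
  refine le_trans (mul_le_mul'
    (ENNReal.rpow_le_rpow (measure_mono (subset_toMeasurable ν A)) hl1.le)
    (ENNReal.rpow_le_rpow (measure_mono (subset_toMeasurable ν B)) hl0.le)) ?_
  rw [hwi hAm, hwi hBm, hwi hCm]
  refine hν l hl _ _ _ (hw.indicator hAm) (hw.indicator hBm) (hw.indicator hCm) ?_
  filter_upwards [ae_prod_toMeasurable hQ hsub] with p hp
  by_cases h1 : p.1 ∈ toMeasurable ν A
  · by_cases h2 : p.2 ∈ toMeasurable ν B
    · rw [indicator_of_mem h1, indicator_of_mem h2, indicator_of_mem (hp h1 h2)]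
      exact hconc _ _
    · simp [h2, hl0]
  · simp [h1, hl1]

theorem setLIntegral_exp_neg_lt {a : EReal} (ha : a ≠ ⊥) :
    ∫⁻ z in {z : ℝ | a < z}, ENNReal.ofReal (Real.exp (-z)) = negExpE a := by
  induction a with
  | bot => exact absurd rfl ha
  | top => simp [negExpE]
  | coe r =>
    have hset : {z : ℝ | (r : EReal) < z} = Ioi r := by ext; simp
    rw [hset, ← ofReal_integral_eq_lintegral_ofReal (integrableOn_exp_neg_Ioi r)
      (ae_of_all _ fun _ => (Real.exp_pos _).le), integral_exp_neg_Ioi]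
    simp [negExpE]

theorem withDensity_epiE {n : ℕ} {φ : (Fin n → ℝ) → EReal} (hφ : Measurable φ)
    (hbot : ∀ x, φ x ≠ ⊥) :
    (volume : Measure ((Fin n → ℝ) × ℝ)).withDensity
      (fun p => ENNReal.ofReal (Real.exp (-p.2))) (epiE φ) = ∫⁻ x, negExpE (φ x) := by
  have hm : MeasurableSet (epiE φ) :=
    measurableSet_lt (hφ.comp measurable_fst) (measurable_coe_real_ereal.comp measurable_snd)
  rw [withDensity_apply _ hm, ← lintegral_indicator hm, Measure.volume_eq_prod,
    lintegral_prod _ (Measurable.indicator (by fun_prop) hm).aemeasurable]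
  refine lintegral_congr fun x => ?_
  rw [← setLIntegral_exp_neg_lt (hbot x),
    ← lintegral_indicator (measurableSet_lt measurable_const measurable_coe_real_ereal)]
  rfl

/-- Prékopa–Leindler via Borell: the measure on `ℝⁿ × ℝ` with density `e^{-z}`
is log-concave, its mass on `epi φ` is `∫ e^{-φ}`, and consequently the
Prékopa–Leindler inequality holds for the sup-convolution `φ □_λ ψ`, defined via
`epi (φ □_λ ψ) = (1-λ) epi φ + λ epi ψ`. -/
theorem prekopa_leindler_via_borell (n : ℕ)
    (μ : Measure ((Fin n → ℝ) × ℝ))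
    (hμ : μ = volume.withDensity (fun p => ENNReal.ofReal (Real.exp (-p.2)))) :
    (∀ A B : Set ((Fin n → ℝ) × ℝ), A.Nonempty → B.Nonempty →
      ∀ l ∈ Set.Ioo (0 : ℝ) 1, μ A ^ (1 - l) * μ B ^ l ≤ μ ((1 - l) • A + l • B)) ∧
    (∀ φ : (Fin n → ℝ) → EReal, Measurable φ → (∀ x, φ x ≠ ⊥) →
      μ (epiE φ) = ∫⁻ x, negExpE (φ x)) ∧
    (∀ φ ψ η : (Fin n → ℝ) → EReal, (∀ x, φ x ≠ ⊥) → (∀ x, ψ x ≠ ⊥) →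
      ∀ l ∈ Set.Ioo (0 : ℝ) 1,
      epiE η = (1 - l) • epiE φ + l • epiE ψ →
      μ (epiE φ) ^ (1 - l) * μ (epiE ψ) ^ l ≤ μ (epiE η)) := by
  have h1 : ∀ A B : Set ((Fin n → ℝ) × ℝ), A.Nonempty → B.Nonempty →
      ∀ l ∈ Set.Ioo (0 : ℝ) 1, μ A ^ (1 - l) * μ B ^ l ≤ μ ((1 - l) • A + l • B) := by
    intro A B _ _ l hl
    rw [hμ]
    refine ((satisfiesPrekopaLeindler_pi n).prod satisfiesPrekopaLeindler_real).withDensity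
      (by fun_prop) hl (fun x y => ?_) A B
    have hl1 : 0 < 1 - l := by linarith [hl.2]
    rw [ENNReal.ofReal_rpow_of_pos (Real.exp_pos _), ENNReal.ofReal_rpow_of_pos (Real.exp_pos _),
      ← Real.exp_mul, ← Real.exp_mul, ← ENNReal.ofReal_mul (Real.exp_pos _).le, ← Real.exp_add]
    refine le_of_eq ?_
    simp only [Prod.snd_add, Prod.smul_snd, smul_eq_mul]
    ring_nf
  refine ⟨h1, fun φ hφ hbot => hμ ▸ withDensity_epiE hφ hbot, fun φ ψ η _ _ l hl hη => ?_⟩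
  have hl1 : 0 < 1 - l := by linarith [hl.2]
  rcases (epiE φ).eq_empty_or_nonempty with hφ | hφ
  · simp [hφ, hl1]
  rcases (epiE ψ).eq_empty_or_nonempty with hψ | hψ
  · simp [hψ, hl.1]
  rw [hη]
  exact h1 _ _ hφ hψ l hl
end
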